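/- arXiv:1711.03932 — 4 statements merged into one kernel-verified Lean document; each statement's English description precedes it below -/
import Mathlib

section
/- Let K be a field of characteristic zero and let R₃ be the quotient of the free associative algebra on two generators A₀, A₁ over K by the two-sided ideal generated by all products of four generators. Then for all a, b, c, d, e, λ ∈ K the following identity holds in R₃: 1 + a·A₀ + b·A₁ + (a²/2)·A₀A₀ + c·A₀A₁ + (a·b − c)·A₁A₀ + (b²/2)·A₁A₁ + (a³/6)·A₀A₀A₀ + ((a·c − d)/2)·A₀A₀A₁ + d·A₀A₁A₀ + e·A₀A₁A₁ + (a²·b/2 − a·c/2 − d/2)·A₁A₀A₀ + (b·c − 2e)·A₁A₀A₁ + (a·b²/2 − b·c + e)·A₁A₁A₀ + (b³/6)·A₁A₁A₁ = exp₃(b·(A₁ + λ·[[A₀,A₁],A₁])) · exp₃(a·A₀ + c·[A₀,A₁] + (d/2)·[A₀,[A₁,A₀]] + (e − λ·b)·[[A₀,A₁],A₁]). (This is the factorization p^{cr}₃(x) = p^H₃(x)·u₃(x) underlying the level-3 de Rham unipotent Albanese map on an elliptic curve, with a = ∫α₀, b = ∫α₁, c = ∫α₀α₁, d = ∫α₀α₁α₀,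 e = ∫α₀α₁α₁, the length-3 iterated-integral coefficients being determined from these by the shuffle relations.) -/
open scoped BigOperators

noncomputable section

/-- The relation on the free algebra whose `RingQuot` is the quotient by the two-sided
ideal generated by all products of `n+1` generators. -/
def truncRel (K : Type*) [CommRing K] (m n : ℕ) :
    FreeAlgebra K (Fin m) → FreeAlgebra K (Fin m) → Prop := fun x y =>
  (∃ f : Fin (n + 1) → Fin m,
      x = (List.ofFn fun t => FreeAlgebra.ι K (f t)).prod) ∧ y = 0

/-- The level-`n` truncated free algebra on `m` generators over `K`:
the quotient of the free associative algebra on `m` generators by the two-sided ideal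
generated by all products of `n+1` generators. -/
abbrev TruncFreeAlgebra (K : Type*) [CommRing K] (m n : ℕ) : Type _ :=
  RingQuot (truncRel K m n)

/-- The image `A_i` of the `i`-th generator in the truncated free algebra. -/
def gen (K : Type*) [CommRing K] (m n : ℕ) (i : Fin m) : TruncFreeAlgebra K m n :=
  RingQuot.mkAlgHom K (truncRel K m n) (FreeAlgebra.ι K i)

/-- The commutator `[x,y] = x*y - y*x`. -/
def br {R : Type*} [Ring R] (x y : R) : R := x * y - y * x

/-- The truncated exponential `exp_N(x) = ∑_{k=0}^{N} x^k / k!`. -/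
def expT (K : Type*) {R : Type*} [Field K] [Ring R] [Algebra K R] (N : ℕ) (x : R) : R :=
  ∑ k ∈ Finset.range (N + 1), (k.factorial : K)⁻¹ • x ^ k

theorem gen_prod_zero (K : Type*) [CommRing K] (i j k l : Fin 2) :
    gen K 2 3 i * (gen K 2 3 j * (gen K 2 3 k * gen K 2 3 l)) = 0 := by
  have h : truncRel K 2 3 (List.ofFn fun t => FreeAlgebra.ι K ((![i, j, k, l] : Fin 4 → Fin 2) t)).prod 0 :=
    ⟨⟨_, rfl⟩, rfl⟩
  have h2 := RingQuot.mkAlgHom_rel K h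
  simpa [List.ofFn_succ, gen] using h2

theorem factor_aux {K R : Type*} [Field K] [CharZero K] [Ring R] [Algebra K R]
    (g : Fin 2 → R) (hg : ∀ i j k l, g i * (g j * (g k * g l)) = 0) (a b c d e lam : K) :
    (1 : R)
        + a • g 0 + b • g 1
        + (a ^ 2 / 2) • (g 0 * g 0) + c • (g 0 * g 1)
        + (a * b - c) • (g 1 * g 0) + (b ^ 2 / 2) • (g 1 * g 1)
        + (a ^ 3 / 6) • (g 0 * g 0 * g 0)
        + ((a * c - d) / 2) • (g 0 * g 0 * g 1)
        + d • (g 0 * g 1 * g 0)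
        + e • (g 0 * g 1 * g 1)
        + (a ^ 2 * b / 2 - a * c / 2 - d / 2) • (g 1 * g 0 * g 0)
        + (b * c - 2 * e) • (g 1 * g 0 * g 1)
        + (a * b ^ 2 / 2 - b * c + e) • (g 1 * g 1 * g 0)
        + (b ^ 3 / 6) • (g 1 * g 1 * g 1)
      =
      expT K 3 (b • (g 1 + lam • br (br (g 0) (g 1)) (g 1)))
        * expT K 3 (a • g 0 + c • br (g 0) (g 1)
            + (d / 2) • br (g 0) (br (g 1) (g 0))
            + (e - lam * b) • br (br (g 0) (g 1)) (g 1)) := by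
  have e1 : expT K 3 (b • (g 1 + lam • br (br (g 0) (g 1)) (g 1))) =
      1 + b • (g 1 + lam • br (br (g 0) (g 1)) (g 1)) + (b ^ 2 / 2) • (g 1 * g 1)
        + (b ^ 3 / 6) • (g 1 * (g 1 * g 1)) := by
    simp only [expT, Finset.sum_range_succ, Finset.sum_range_zero, br, pow_succ, pow_zero, one_mul,
      mul_add, add_mul, mul_sub, sub_mul, smul_mul_assoc, mul_smul_comm, mul_assoc, hg,
      mul_zero, smul_zero, Nat.factorial, smul_add, smul_sub, add_zero, zero_add, sub_zero]
    norm_num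
    module
  have e2 : expT K 3 (a • g 0 + c • br (g 0) (g 1)
            + (d / 2) • br (g 0) (br (g 1) (g 0))
            + (e - lam * b) • br (br (g 0) (g 1)) (g 1)) =
      1 + (a • g 0 + c • br (g 0) (g 1)
            + (d / 2) • br (g 0) (br (g 1) (g 0))
            + (e - lam * b) • br (br (g 0) (g 1)) (g 1))
        + (a ^ 2 / 2) • (g 0 * g 0)
        + (a * c / 2) • (g 0 * br (g 0) (g 1) + br (g 0) (g 1) * g 0)
        + (a ^ 3 / 6) • (g 0 * (g 0 * g 0)) := by
    simp only [expT, Finset.sum_range_succ, Finset.sum_range_zero, br, pow_succ, pow_zero, one_mul,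
      mul_add, add_mul, mul_sub, sub_mul, smul_mul_assoc, mul_smul_comm, mul_assoc, hg,
      mul_zero, smul_zero, Nat.factorial, smul_add, smul_sub, add_zero, zero_add, sub_zero]
    norm_num
    module
  rw [e1, e2]
  simp only [br, one_mul, mul_one,
      mul_add, add_mul, mul_sub, sub_mul, smul_mul_assoc, mul_smul_comm, mul_assoc, hg,
      mul_zero, smul_zero, smul_add, smul_sub, add_zero, zero_add, sub_zero]
  module

/-- the factorization `p^{cr}₃(x) = p^H₃(x)·u₃(x)` underlying the level-3
de Rham unipotent Albanese map on an elliptic curve, as an identity in the level-3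
truncated free algebra `R₃` on two generators `A₀, A₁` over a field `K` of
characteristic zero. -/
theorem level3_elliptic_period_map_factorization
    (K : Type*) [Field K] [CharZero K] (a b c d e lam : K) :
    let A0 := gen K 2 3 0
    let A1 := gen K 2 3 1
    (1 : TruncFreeAlgebra K 2 3)
        + a • A0 + b • A1
        + (a ^ 2 / 2) • (A0 * A0) + c • (A0 * A1)
        + (a * b - c) • (A1 * A0) + (b ^ 2 / 2) • (A1 * A1)
        + (a ^ 3 / 6) • (A0 * A0 * A0)
        + ((a * c - d) / 2) • (A0 * A0 * A1)
        + d • (A0 * A1 * A0)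
        + e • (A0 * A1 * A1)
        + (a ^ 2 * b / 2 - a * c / 2 - d / 2) • (A1 * A0 * A0)
        + (b * c - 2 * e) • (A1 * A0 * A1)
        + (a * b ^ 2 / 2 - b * c + e) • (A1 * A1 * A0)
        + (b ^ 3 / 6) • (A1 * A1 * A1)
      =
      expT K 3 (b • (A1 + lam • br (br A0 A1) A1))
        * expT K 3 (a • A0 + c • br A0 A1
            + (d / 2) • br A0 (br A1 A0)
            + (e - lam * b) • br (br A0 A1) A1) := by
  exact factor_aux (gen K 2 3) (gen_prod_zero K) a b c d e lam
end
end

section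
/- Let K be a field of characteristic zero, let g ≥ 1, and let R₂ be the quotient of the free associative algebra on 2g generators A₀, …, A_{2g−1} over K by the two-sided ideal generated by all products of three generators. Let a : Fin 2g → K and c : Fin 2g → Fin 2g → K satisfy c(k,l) + c(l,k) = a(k)·a(l) for all k, l, and let γ : Fin 2g → Fin 2g → Fin 2g → K be arbitrary. Then the following identity holds in R₂: 1 + Σ_k a(k)·A_k + Σ_{k,l} c(k,l)·A_k A_l = exp₂(X) · exp₂(u), where X := Σ_{k ≥ g} a(k)·( A_k + Σ_{i < g} Σ_{j ≥ g} γ(i,j,k)·[A_i,A_j] ) + (1/2)·Σ_{k ≥ g} Σ_{l ≥ g} c(k,l)·[A_k,A_l], and u := Σ_{k < g} a(k)·A_k + (1/2)·Σ_{k < g} Σ_{l < g} c(k,l)·[A_k,A_l] + Σ_{k < g} Σ_{l ≥ g} c(k,l)·[A_k,A_l] + Σ_{k ≥ g} Σ_{i < g} Σ_{j ≥ g} γ(i,j,k)·a(k)·[A_j,A_i]. (This is the factorization p^{cr}₂(x) = p^H₂(x)·u₂(x) underlying the level-2 de Rham unipotent Albanese map on a genus-g odd hyperelliptic curve, with a(k)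 = ∫α_k and c(k,l) = ∫α_kα_l; the hypothesis on c encodes the shuffle relation for iterated integrals, and the γ(i,j,k) are the constants c_{ijk} appearing in the Hodge filtration of U₂.) -/
open scoped BigOperators

noncomputable section

section Aux
variable {K R : Type*} [Field K] [CharZero K] [Ring R] [Algebra K R]

lemma aux_exp (M : Submodule K R) (hM : M ^ 3 = ⊥) (x1 u1 x2 u2 : R)
    (hx1 : x1 ∈ M) (hu1 : u1 ∈ M) (hx2 : x2 ∈ M ^ 2) (hu2 : u2 ∈ M ^ 2) :
    expT K 2 (x1 + x2) * expT K 2 (u1 + u2) =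
      1 + (x1 + u1) + (x2 + u2 + (2 : K)⁻¹ • (x1 * x1) + (2 : K)⁻¹ • (u1 * u1) + x1 * u1) := by
  have h12 : ∀ x ∈ M, ∀ y ∈ M ^ 2, x * y = 0 := by
    intro x hx y hy
    have := Submodule.mul_mem_mul hx hy
    rw [← pow_succ', hM] at this
    simpa using this
  have h21 : ∀ x ∈ M ^ 2, ∀ y ∈ M, x * y = 0 := by
    intro x hx y hy
    have := Submodule.mul_mem_mul hx hy
    rw [← pow_succ, hM] at this
    simpa using this
  have h22 : ∀ x ∈ M ^ 2, ∀ y ∈ M ^ 2, x * y = 0 := by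
    intro x hx y hy
    have := Submodule.mul_mem_mul hx hy
    rw [← pow_add, show 2 + 2 = 3 + 1 from rfl, pow_succ, hM] at this
    simpa using this
  have hm : ∀ x ∈ M, ∀ y ∈ M, x * y ∈ M ^ 2 := by
    intro x hx y hy
    rw [pow_two]
    exact Submodule.mul_mem_mul hx hy
  have e1 : (x1 + x2) ^ 2 = x1 * x1 := by
    rw [pow_two, add_mul, mul_add, mul_add, h12 _ hx1 _ hx2, h21 _ hx2 _ hx1, h22 _ hx2 _ hx2]
    simp
  have e2 : (u1 + u2) ^ 2 = u1 * u1 := by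
    rw [pow_two, add_mul, mul_add, mul_add, h12 _ hu1 _ hu2, h21 _ hu2 _ hu1, h22 _ hu2 _ hu2]
    simp
  have hX := hm _ hx1 _ hx1
  have hU := hm _ hu1 _ hu1
  simp only [expT, Finset.sum_range_succ, Finset.sum_range_zero, e1, e2]
  simp only [Nat.factorial, pow_zero, pow_one, Nat.cast_one, inv_one, one_smul, zero_add,
    Nat.succ_eq_add_one, mul_one, Nat.reduceAdd, Nat.cast_ofNat]
  simp only [add_mul, mul_add, one_mul, mul_one, smul_mul_assoc, mul_smul_comm,
    h12 _ hx1 _ hu2, h21 _ hx2 _ hu1, h22 _ hx2 _ hu2, h12 _ hx1 _ hU, h22 _ hx2 _ hU,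
    h21 _ hX _ hu1, h22 _ hX _ hu2, h22 _ hX _ hU, smul_zero, add_zero]
  abel

lemma aux_half {ι : Type*} (s : Finset ι) (a : ι → K) (c : ι → ι → K)
    (h : ∀ k l, c k l + c l k = a k * a l) (A : ι → R) :
    ((1 : K) / 2) • (∑ k ∈ s, ∑ l ∈ s, c k l • br (A k) (A l))
      + (2 : K)⁻¹ • ((∑ k ∈ s, a k • A k) * (∑ k ∈ s, a k • A k))
      = ∑ k ∈ s, ∑ l ∈ s, c k l • (A k * A l) := by
  have e : ∑ k ∈ s, ∑ l ∈ s, c k l • (A l * A k) = ∑ k ∈ s, ∑ l ∈ s, c l k • (A k * A l) :=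
    Finset.sum_comm
  have e3 : (∑ k ∈ s, a k • A k) * (∑ k ∈ s, a k • A k)
      = ∑ k ∈ s, ∑ l ∈ s, c k l • (A k * A l) + ∑ k ∈ s, ∑ l ∈ s, c l k • (A k * A l) := by
    simp only [Finset.sum_mul_sum, ← Finset.sum_add_distrib, smul_mul_smul_comm, ← h, add_smul]
  rw [e3]
  simp only [br, smul_sub, Finset.sum_sub_distrib]
  rw [e]
  module

lemma aux_mixed {ι : Type*} (s t : Finset ι) (a : ι → K) (c : ι → ι → K)
    (h : ∀ k l, c k l + c l k = a k * a l) (A : ι → R) :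
    (∑ k ∈ s, ∑ l ∈ t, c k l • br (A k) (A l))
      + (∑ k ∈ t, a k • A k) * (∑ k ∈ s, a k • A k)
      = (∑ k ∈ s, ∑ l ∈ t, c k l • (A k * A l)) + ∑ k ∈ t, ∑ l ∈ s, c k l • (A k * A l) := by
  have e : ∑ k ∈ s, ∑ l ∈ t, c k l • (A l * A k) = ∑ k ∈ t, ∑ l ∈ s, c l k • (A k * A l) :=
    Finset.sum_comm
  have e3 : (∑ k ∈ t, a k • A k) * (∑ k ∈ s, a k • A k)
      = ∑ k ∈ t, ∑ l ∈ s, c k l • (A k * A l) + ∑ k ∈ t, ∑ l ∈ s, c l k • (A k * A l) := by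
    simp only [Finset.sum_mul_sum, ← Finset.sum_add_distrib, smul_mul_smul_comm, ← h, add_smul]
  rw [e3]
  simp only [br, smul_sub, Finset.sum_sub_distrib]
  rw [e]
  abel

lemma aux_main {ι : Type*} [Fintype ι] (p q : ι → Prop) [DecidablePred p] [DecidablePred q]
    (hpq : ∀ i, q i ↔ ¬ p i) (a : ι → K) (c : ι → ι → K)
    (h : ∀ k l, c k l + c l k = a k * a l) (γ : ι → ι → ι → K) (A : ι → R)
    (hA : ∀ i j k, A i * A j * A k = 0) :
    (1 : R) + (∑ k, a k • A k) + (∑ k, ∑ l, c k l • (A k * A l)) =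
    expT K 2 ((∑ k ∈ Finset.univ.filter q, a k • (A k +
            ∑ i ∈ Finset.univ.filter p, ∑ j ∈ Finset.univ.filter q, γ i j k • br (A i) (A j)))
        + ((1 : K) / 2) • ∑ k ∈ Finset.univ.filter q, ∑ l ∈ Finset.univ.filter q,
                c k l • br (A k) (A l)) *
    expT K 2 ((∑ k ∈ Finset.univ.filter p, a k • A k)
        + ((1 : K) / 2) • ∑ k ∈ Finset.univ.filter p, ∑ l ∈ Finset.univ.filter p,
                c k l • br (A k) (A l)
        + (∑ k ∈ Finset.univ.filter p, ∑ l ∈ Finset.univ.filter q, c k l • br (A k) (A l))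
        + (∑ k ∈ Finset.univ.filter q, ∑ i ∈ Finset.univ.filter p, ∑ j ∈ Finset.univ.filter q,
                (γ i j k * a k) • br (A j) (A i))) := by
  have hq : Finset.univ.filter q = Finset.univ.filter (fun i => ¬ p i) := by
    ext i; simp [hpq]
  have hsplit : ∀ f : ι → R, ∑ i, f i
      = ∑ i ∈ Finset.univ.filter p, f i + ∑ i ∈ Finset.univ.filter q, f i := by
    intro f
    rw [hq, Finset.sum_filter_add_sum_filter_not]
  generalize Finset.univ.filter p = P at *
  generalize Finset.univ.filter q = Q at *
  set M : Submodule K R := Submodule.span K (Set.range A) with hMdef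
  have hAM : ∀ i, A i ∈ M := fun i => Submodule.subset_span ⟨i, rfl⟩
  have hM : M ^ 3 = ⊥ := by
    rw [pow_succ, pow_two, hMdef, Submodule.span_mul_span, Submodule.span_mul_span,
      Submodule.span_eq_bot]
    rintro _ ⟨_, ⟨_, ⟨i, rfl⟩, _, ⟨j, rfl⟩, rfl⟩, _, ⟨k, rfl⟩, rfl⟩
    exact hA i j k
  have hbr : ∀ i j, br (A i) (A j) ∈ M ^ 2 := by
    intro i j
    rw [pow_two]
    exact Submodule.sub_mem _ (Submodule.mul_mem_mul (hAM i) (hAM j))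
      (Submodule.mul_mem_mul (hAM j) (hAM i))
  have hlin : ∀ s : Finset ι, ∑ k ∈ s, a k • A k ∈ M := fun s =>
    Submodule.sum_mem _ fun k _ => Submodule.smul_mem _ _ (hAM k)
  have hdbl : ∀ (s t : Finset ι) (d : ι → ι → K),
      ∑ k ∈ s, ∑ l ∈ t, d k l • br (A k) (A l) ∈ M ^ 2 := fun s t d =>
    Submodule.sum_mem _ fun k _ => Submodule.sum_mem _ fun l _ =>
      Submodule.smul_mem _ _ (hbr k l)
  have hG : (∑ k ∈ Q, ∑ i ∈ P, ∑ j ∈ Q, (γ i j k * a k) • br (A j) (A i))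
      = - ∑ k ∈ Q, a k • ∑ i ∈ P, ∑ j ∈ Q, γ i j k • br (A i) (A j) := by
    simp only [← Finset.sum_neg_distrib, Finset.smul_sum]
    refine Finset.sum_congr rfl fun k _ => Finset.sum_congr rfl fun i _ =>
      Finset.sum_congr rfl fun j _ => ?_
    simp only [br]
    module
  have hGm : ∑ k ∈ Q, a k • ∑ i ∈ P, ∑ j ∈ Q, γ i j k • br (A i) (A j) ∈ M ^ 2 :=
    Submodule.sum_mem _ fun k _ => Submodule.smul_mem _ _ (hdbl P Q fun i j => γ i j k)
  rw [hG]
  simp only [smul_add, Finset.sum_add_distrib]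
  rw [add_assoc (∑ k ∈ Q, a k • A k), add_assoc (∑ k ∈ P, a k • A k),
    add_assoc (∑ k ∈ P, a k • A k),
    aux_exp M hM _ _ _ _ (hlin Q) (hlin P)
      (Submodule.add_mem _ hGm (Submodule.smul_mem _ _ (hdbl Q Q c)))
      (Submodule.add_mem _ (Submodule.add_mem _ (Submodule.smul_mem _ _ (hdbl P P c))
        (hdbl P Q c)) (Submodule.neg_mem _ hGm))]
  have i1 := aux_half P a c h A
  have i2 := aux_half Q a c h A
  have i3 := aux_mixed P Q a c h A
  have i4 : ∑ k, ∑ l, c k l • (A k * A l) =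
      (∑ k ∈ P, ∑ l ∈ P, c k l • (A k * A l)) + (∑ k ∈ Q, ∑ l ∈ Q, c k l • (A k * A l))
      + ((∑ k ∈ P, ∑ l ∈ Q, c k l • (A k * A l)) + ∑ k ∈ Q, ∑ l ∈ P, c k l • (A k * A l)) := by
    rw [hsplit]
    simp only [hsplit (fun l => c _ l • (A _ * A l)), Finset.sum_add_distrib]
    abel
  rw [i4, hsplit, ← i1, ← i2, ← i3]
  abel

end Aux

lemma gen_triple (K : Type*) [Field K] (m : ℕ) (i j k : Fin m) :
    gen K m 2 i * gen K m 2 j * gen K m 2 k = 0 := by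
  have h : truncRel K m 2
      (FreeAlgebra.ι K i * FreeAlgebra.ι K j * FreeAlgebra.ι K k) 0 :=
    ⟨⟨![i, j, k], by simp [List.ofFn_succ, mul_assoc]⟩, rfl⟩
  have := RingQuot.mkAlgHom_rel K h
  simpa [gen] using this

/-- the factorization `p^{cr}₂(x) = p^H₂(x)·u₂(x)` underlying the level-2
de Rham unipotent Albanese map on a genus-`g` odd hyperelliptic curve, as an identity in
the level-2 truncated free algebra `R₂` on `2g` generators over a field `K` of
characteristic zero.  The hypothesis `c k l + c l k = a k · a l` encodes the shuffle
relation for iterated integrals, and `γ i j k` are the constants `c_{ijk}` from the Hodge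
filtration of `U₂`. -/
theorem level2_hyperelliptic_period_map_factorization
    (K : Type*) [Field K] [CharZero K] (g : ℕ) (hg : 1 ≤ g)
    (a : Fin (2 * g) → K) (c : Fin (2 * g) → Fin (2 * g) → K)
    (hshuffle : ∀ k l, c k l + c l k = a k * a l)
    (γ : Fin (2 * g) → Fin (2 * g) → Fin (2 * g) → K) :
    let A : Fin (2 * g) → TruncFreeAlgebra K (2 * g) 2 := gen K (2 * g) 2
    let X : TruncFreeAlgebra K (2 * g) 2 :=
      (∑ k ∈ Finset.univ.filter (fun k : Fin (2 * g) => g ≤ (k : ℕ)),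
          a k • (A k +
            ∑ i ∈ Finset.univ.filter (fun i : Fin (2 * g) => (i : ℕ) < g),
              ∑ j ∈ Finset.univ.filter (fun j : Fin (2 * g) => g ≤ (j : ℕ)),
                γ i j k • br (A i) (A j)))
        + ((1 : K) / 2) •
            ∑ k ∈ Finset.univ.filter (fun k : Fin (2 * g) => g ≤ (k : ℕ)),
              ∑ l ∈ Finset.univ.filter (fun l : Fin (2 * g) => g ≤ (l : ℕ)),
                c k l • br (A k) (A l)
    let u : TruncFreeAlgebra K (2 * g) 2 :=
      (∑ k ∈ Finset.univ.filter (fun k : Fin (2 * g) => (k : ℕ) < g), a k • A k)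
        + ((1 : K) / 2) •
            ∑ k ∈ Finset.univ.filter (fun k : Fin (2 * g) => (k : ℕ) < g),
              ∑ l ∈ Finset.univ.filter (fun l : Fin (2 * g) => (l : ℕ) < g),
                c k l • br (A k) (A l)
        + (∑ k ∈ Finset.univ.filter (fun k : Fin (2 * g) => (k : ℕ) < g),
            ∑ l ∈ Finset.univ.filter (fun l : Fin (2 * g) => g ≤ (l : ℕ)),
              c k l • br (A k) (A l))
        + (∑ k ∈ Finset.univ.filter (fun k : Fin (2 * g) => g ≤ (k : ℕ)),
            ∑ i ∈ Finset.univ.filter (fun i : Fin (2 * g) => (i : ℕ) < g),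
              ∑ j ∈ Finset.univ.filter (fun j : Fin (2 * g) => g ≤ (j : ℕ)),
                (γ i j k * a k) • br (A j) (A i))
    (1 : TruncFreeAlgebra K (2 * g) 2)
        + (∑ k : Fin (2 * g), a k • A k)
        + (∑ k : Fin (2 * g), ∑ l : Fin (2 * g), c k l • (A k * A l))
      = expT K 2 X * expT K 2 u := by
  intro A X u
  exact aux_main (fun k : Fin (2 * g) => (k : ℕ) < g) (fun k : Fin (2 * g) => g ≤ (k : ℕ))
    (fun i => not_lt.symm) a c hshuffle γ A (gen_triple K (2 * g))
end
end

section
/- Let K be a field of characteristic zero and let R₃ be the quotient of the free associative algebra on two generators A₀, A₁ over K by the two-sided ideal generated by all products of four generators. Let a, b, c, u, v, m, s, w, x, y, z, λ ∈ K satisfy w + x = m·a and y + z = m·b. Define P := 1 + a·A₀ + b·A₁ + (a²/2)·A₀A₀ + (c+m)·A₀A₁ + (a·b − c − m)·A₁A₀ + (b²/2)·A₁A₁ + (a³/6)·A₀A₀A₀ + ((a·c − u)/2 + x)·A₀A₀A₁ + (u + w − x)·A₀A₁A₀ + (v + s + y)·A₀A₁A₁ + (a²·b/2 − a·c/2 −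 u/2 − w)·A₁A₀A₀ + (b·c − 2v − 2s − y + z)·A₁A₀A₁ + (a·b²/2 − b·c + v + s − z)·A₁A₁A₀ + (b³/6)·A₁A₁A₁. Then P = exp₃(b·(A₁ + λ·[[A₀,A₁],A₁])) · exp₃( a·A₀ + (c+m)·[A₀,A₁] + ((u + w − x)/2)·[A₀,[A₁,A₀]] + (v + y + s − λ·b)·[[A₀,A₁],A₁] ). (This is the factorization underlying the level-3 de Rham unipotent Albanese map on an elliptic curve with tangential basepoint at infinity, with a = ∫α₀, b = ∫α₁′, c = ∫α₀α₁′, u = ∫α₀α₁′α₀, v = ∫α₀α₁′α₁′, m = ∫Fα₀, s = ∫α₀′, w = ∫Fα₀·α₀, x = ∫α₀·Fα₀, y = ∫Fα₀·α₁′, z = ∫α₁′·Fα₀, where α₁′ = α₁ − dF and α₀′ = (1/2)F²α₀ − λdF; the two hypotheses are the shuffle relations.) -/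
open scoped BigOperators

noncomputable section

theorem gen_four (K : Type*) [Field K] (i j k l : Fin 2) :
    gen K 2 3 i * (gen K 2 3 j * (gen K 2 3 k * gen K 2 3 l)) = 0 := by
  have h := RingQuot.mkAlgHom_rel K (s := truncRel K 2 3)
    (x := (List.ofFn fun t => FreeAlgebra.ι K ((![i, j, k, l] : Fin 4 → Fin 2) t)).prod)
    (y := 0) ⟨⟨![i, j, k, l], rfl⟩, rfl⟩
  simpa [List.ofFn_succ, gen] using h

theorem fact_aux {K R : Type*} [Field K] [CharZero K] [Ring R] [Algebra K R] (A B : R)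
    (h4 : ∀ p q r t : R, (p = A ∨ p = B) → (q = A ∨ q = B) → (r = A ∨ r = B) →
      (t = A ∨ t = B) → p * (q * (r * t)) = 0)
    (a b c u v m s w x y z lam : K)
    (hshuffle1 : w + x = m * a) (hshuffle2 : y + z = m * b) :
    (1 : R)
        + a • A + b • B
        + (a ^ 2 / 2) • (A * A) + (c + m) • (A * B)
        + (a * b - c - m) • (B * A) + (b ^ 2 / 2) • (B * B)
        + (a ^ 3 / 6) • (A * A * A)
        + ((a * c - u) / 2 + x) • (A * A * B)
        + (u + w - x) • (A * B * A)
        + (v + s + y) • (A * B * B)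
        + (a ^ 2 * b / 2 - a * c / 2 - u / 2 - w) • (B * A * A)
        + (b * c - 2 * v - 2 * s - y + z) • (B * A * B)
        + (a * b ^ 2 / 2 - b * c + v + s - z) • (B * B * A)
        + (b ^ 3 / 6) • (B * B * B)
      =
      expT K 3 (b • (B + lam • br (br A B) B))
        * expT K 3 (a • A + (c + m) • br A B
            + ((u + w - x) / 2) • br A (br B A)
            + (v + y + s - lam * b) • br (br A B) B) := by
  have z4 : ∀ p q r t : R, (p = A ∨ p = B) → (q = A ∨ q = B) → (r = A ∨ r = B) →
      (t = A ∨ t = B) → ∀ e, p * (q * (r * (t * e))) = 0 := by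
    intro p q r t hp hq hr ht e
    have := congrArg (· * e) (h4 p q r t hp hq hr ht)
    simpa [mul_assoc] using this
  set D := br (br A B) B with hD
  set E := br A (br B A) with hE
  set C := br A B with hC
  have hC2 : C = A * B - B * A := rfl
  have hD2 : D = A * (B * B) - (2 : K) • (B * (A * B)) + B * (B * A) := by
    rw [hD, hC, two_smul]; simp only [br]; noncomm_ring
  have hE2 : E = (2 : K) • (A * (B * A)) - A * (A * B) - B * (A * A) := by
    rw [hE, two_smul]; simp only [br]; noncomm_ring
  clear_value C D E
  have QD : ∀ q : R, (q = A ∨ q = B) → q * D = 0 ∧ D * q = 0 ∧ q * E = 0 ∧ E * q = 0 ∧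
      (∀ p, (p = A ∨ p = B) → q * (p * C) = 0 ∧ q * (C * p) = 0 ∧ C * (q * p) = 0) := by
    intro q hq
    subst hC2 hD2 hE2
    refine ⟨?_, ?_, ?_, ?_, fun p hp => ?_⟩
    rotate_right
    · simp [mul_sub, sub_mul, mul_assoc, h4, hq, hp]
    all_goals simp [mul_add, add_mul, mul_sub, sub_mul, mul_assoc, h4, hq]
  have CC : C * C = 0 := by
    subst hC2; simp [mul_sub, sub_mul, mul_assoc, h4]
  have hQ : ∀ q : R, (q = A ∨ q = B) → C * D = 0 ∧ C * E = 0 ∧ D * C = 0 ∧ E * C = 0 ∧ D * D = 0 ∧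
      D * E = 0 ∧ E * D = 0 ∧ E * E = 0 := by
    intro q hq
    subst hC2 hD2 hE2
    refine ⟨?_, ?_, ?_, ?_, ?_, ?_, ?_, ?_⟩ <;>
    simp [mul_add, add_mul, mul_sub, sub_mul, mul_assoc, z4, h4]
  obtain ⟨AD, DA, AE, EA, hA⟩ := QD A (Or.inl rfl)
  obtain ⟨BD, DB, BE, EB, hB⟩ := QD B (Or.inr rfl)
  obtain ⟨AAC, ACA, CAA⟩ := hA A (Or.inl rfl)
  obtain ⟨BAC, BCA, CBA⟩ := hB A (Or.inl rfl)
  obtain ⟨ABC, ACB, CAB⟩ := hA B (Or.inr rfl)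
  obtain ⟨BBC, BCB, CBB⟩ := hB B (Or.inr rfl)
  obtain ⟨CD, CE, DC, EC, DD, DE, ED, EE⟩ := hQ A (Or.inl rfl)
  have CAC : C * (A * C) = 0 := by
    subst hC2; simp [mul_sub, sub_mul, mul_assoc, h4]
  have DAe : ∀ e, D * (A * e) = 0 := fun e => by rw [← mul_assoc, DA, zero_mul]
  have DCe : ∀ e, D * (C * e) = 0 := fun e => by rw [← mul_assoc, DC, zero_mul]
  have e1 : expT K 3 (b • (B + lam • D)) =
      1 + b • B + (b * lam) • D + (b ^ 2 / 2) • (B * B) + (b ^ 3 / 6) • (B * (B * B)) := by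
    have s2 : (b • (B + lam • D)) ^ 2 = (b ^ 2) • (B * B) := by
      simp only [pow_two, mul_add, add_mul, smul_mul_assoc, mul_smul_comm, BD, DB, DD, smul_zero,
        smul_add, add_zero]
      module
    have s3 : (b • (B + lam • D)) ^ 3 = (b ^ 3) • (B * (B * B)) := by
      rw [pow_succ, s2]
      simp only [mul_add, smul_mul_assoc, mul_smul_comm, mul_assoc, BD, smul_zero, mul_zero,
        smul_add, add_zero]
      module
    simp only [expT, Finset.sum_range_succ, Finset.sum_range_zero, s2, s3, pow_zero, pow_one,
      Nat.factorial]
    push_cast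
    module
  have e2 : ∀ k g h : K, expT K 3 (a • A + k • C + g • E + h • D) =
      1 + a • A + k • C + g • E + h • D + (a ^ 2 / 2) • (A * A) + (a * k / 2) • (A * C)
        + (a * k / 2) • (C * A) + (a ^ 3 / 6) • (A * (A * A)) := by
    intro k g h
    have s2 : (a • A + k • C + g • E + h • D) ^ 2 =
        (a ^ 2) • (A * A) + (a * k) • (A * C) + (a * k) • (C * A) := by
      simp only [pow_two, mul_add, add_mul, smul_mul_assoc, mul_smul_comm, smul_zero,
        smul_add, add_zero, zero_add, AD, DA, AE, EA, CC, CD, CE, DC, EC, DD, DE, ED, EE]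
      module
    have s3 : (a • A + k • C + g • E + h • D) ^ 3 = (a ^ 3) • (A * (A * A)) := by
      rw [pow_succ, s2]
      simp only [mul_add, add_mul, smul_mul_assoc, mul_smul_comm, mul_assoc, smul_zero, mul_zero,
        smul_add, add_zero, zero_add, AD, AE, CC, CD, CE, AAC, ACA, CAA, CAC]
      module
    simp only [expT, Finset.sum_range_succ, Finset.sum_range_zero, s2, s3, pow_zero, pow_one,
      Nat.factorial]
    push_cast
    module
  rw [e1, e2]
  simp only [mul_add, add_mul, smul_mul_assoc, mul_smul_comm, smul_zero, mul_zero, mul_one, one_mul,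
    smul_add, add_zero, zero_add, mul_assoc, BD, BE, DA, DAe, DCe, DC, DD, DE, BBC, BAC, BCA, h4, z4,
    true_or, or_true]
  have hx : x = m * a - w := by linear_combination hshuffle1
  have hz : z = m * b - y := by linear_combination hshuffle2
  subst hC2 hD2 hE2 hx hz
  simp only [mul_sub, sub_mul, mul_assoc]
  module

/-- the factorization underlying the level-3 de Rham unipotent Albanese map
on an elliptic curve with tangential basepoint at infinity, as an identity in the level-3
truncated free algebra `R₃` on two generators `A₀, A₁` over a field `K` of characteristic
zero; the hypotheses `w + x = m·a` and `y + z = m·b` are the shuffle relations. -/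
theorem level3_elliptic_tangential_period_map_factorization
    (K : Type*) [Field K] [CharZero K] (a b c u v m s w x y z lam : K)
    (hshuffle1 : w + x = m * a) (hshuffle2 : y + z = m * b) :
    let A0 := gen K 2 3 0
    let A1 := gen K 2 3 1
    (1 : TruncFreeAlgebra K 2 3)
        + a • A0 + b • A1
        + (a ^ 2 / 2) • (A0 * A0) + (c + m) • (A0 * A1)
        + (a * b - c - m) • (A1 * A0) + (b ^ 2 / 2) • (A1 * A1)
        + (a ^ 3 / 6) • (A0 * A0 * A0)
        + ((a * c - u) / 2 + x) • (A0 * A0 * A1)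
        + (u + w - x) • (A0 * A1 * A0)
        + (v + s + y) • (A0 * A1 * A1)
        + (a ^ 2 * b / 2 - a * c / 2 - u / 2 - w) • (A1 * A0 * A0)
        + (b * c - 2 * v - 2 * s - y + z) • (A1 * A0 * A1)
        + (a * b ^ 2 / 2 - b * c + v + s - z) • (A1 * A1 * A0)
        + (b ^ 3 / 6) • (A1 * A1 * A1)
      =
      expT K 3 (b • (A1 + lam • br (br A0 A1) A1))
        * expT K 3 (a • A0 + (c + m) • br A0 A1
            + ((u + w - x) / 2) • br A0 (br A1 A0)
            + (v + y + s - lam * b) • br (br A0 A1) A1) := by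
  intro A0 A1
  refine fact_aux A0 A1 ?_ a b c u v m s w x y z lam hshuffle1 hshuffle2
  rintro p q r t (rfl | rfl) (rfl | rfl) (rfl | rfl) (rfl | rfl) <;> exact gen_four K _ _ _ _
end
end

section
/- Let K be a commutative ring, let m ≥ 1, let R := FreeAlgebra K (Fin m) be the free associative algebra on generators A₀, …, A_{m−1}, and let Δ : R → R ⊗_K R be the unique K-algebra homomorphism with Δ(A_i) = A_i ⊗ 1 + 1 ⊗ A_i for every i. For N ≥ 1 let I^N denote the two-sided ideal of R generated by all products of N of the generators, and for n ≥ 0 let q_n : R → R/I^{n+1} be the quotient map. Then for all n, n′ ≥ 0 and every x ∈ I^{n+n′+1}, the element (q_n ⊗ q_{n′})(Δ(x)) is zero in (R/I^{n+1}) ⊗_K (R/I^{n′+1}). Consequently Δ descends to a well-defined map R/I^{n+n′+1} → (R/I^{n+1}) ⊗_K (R/I^{n′+1}) sending 1 to 1⊗1 and each A_i to A_i⊗1 + 1⊗A_i. (This is the algebraic content of the lemma asserting the existence of the unique morphism Δ : U_{n+n′} → U_n ⊗ U_{n′} with Δ(1) = 1⊗1 and Δ(A_i) = A_i⊗1 +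 1⊗A_i.) -/
open scoped TensorProduct

noncomputable section

theorem aux_word_zero (K : Type*) [CommRing K] (m n : ℕ) (l : List (Fin m))
    (hl : n + 1 ≤ l.length) :
    RingQuot.mkAlgHom K (truncRel K m n) (l.map (FreeAlgebra.ι K)).prod = 0 := by
  have h0 : RingQuot.mkAlgHom K (truncRel K m n)
      ((l.take (n + 1)).map (FreeAlgebra.ι K)).prod = 0 := by
    rw [← map_zero (RingQuot.mkAlgHom K (truncRel K m n))]
    apply RingQuot.mkAlgHom_rel
    refine ⟨⟨fun t => l.get (t.castLE hl), ?_⟩, rfl⟩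
    congr 1
    apply List.ext_getElem
    · simp [hl]
    · intro i h1 h2
      simp [-List.ofFn_succ]
  rw [← List.take_append_drop (n + 1) l, List.map_append, List.prod_append, map_mul, h0, zero_mul]

theorem aux_key (K : Type*) [CommRing K] (m n n' : ℕ) (l : List (Fin m)) :
    ∀ u v : List (Fin m), n + n' + 1 ≤ u.length + v.length + l.length →
    ((RingQuot.mkAlgHom K (truncRel K m n) (u.map (FreeAlgebra.ι K)).prod) ⊗ₜ[K]
      (RingQuot.mkAlgHom K (truncRel K m n') (v.map (FreeAlgebra.ι K)).prod)) *
    (l.map fun i => gen K m n i ⊗ₜ[K] (1 : TruncFreeAlgebra K m n') +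
        (1 : TruncFreeAlgebra K m n) ⊗ₜ[K] gen K m n' i).prod = 0 := by
  induction l with
  | nil =>
    intro u v h
    simp only [List.length_nil] at h
    rcases Nat.lt_or_ge n u.length with h1 | h1
    · rw [aux_word_zero K m n u h1, TensorProduct.zero_tmul, zero_mul]
    · rw [aux_word_zero K m n' v (by omega), TensorProduct.tmul_zero, zero_mul]
  | cons a l ih =>
    intro u v h
    simp only [List.length_cons] at h
    have e1 := ih (u ++ [a]) v (by simp; omega)
    have e2 := ih u (v ++ [a]) (by simp; omega)
    simp only [List.map_append, List.prod_append, List.map_cons, List.map_nil,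
      List.prod_singleton, map_mul] at e1 e2
    rw [List.map_cons, List.prod_cons, ← mul_assoc, mul_add,
      Algebra.TensorProduct.tmul_mul_tmul, Algebra.TensorProduct.tmul_mul_tmul, mul_one, mul_one,
      add_mul]
    unfold gen at *
    rw [e1, e2, add_zero]

/-- the coproduct `Δ` on the free algebra, i.e. the unique `K`-algebra map
with `Δ(A_i) = A_i ⊗ 1 + 1 ⊗ A_i`, sends the two-sided ideal `I^{n+n′+1}` into the
kernel of `q_n ⊗ q_{n′}`, and consequently descends to a well-defined map
`R/I^{n+n′+1} → (R/I^{n+1}) ⊗ (R/I^{n′+1})` sending `1` to `1⊗1` and each `A_i` to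
`A_i⊗1 + 1⊗A_i`. -/
theorem coproduct_descends_to_truncations
    (K : Type*) [CommRing K] (m : ℕ) (hm : 1 ≤ m) (n n' : ℕ) :
    let Δ : FreeAlgebra K (Fin m) →ₐ[K]
        (FreeAlgebra K (Fin m) ⊗[K] FreeAlgebra K (Fin m)) :=
      FreeAlgebra.lift K fun i =>
        FreeAlgebra.ι K i ⊗ₜ[K] (1 : FreeAlgebra K (Fin m))
          + (1 : FreeAlgebra K (Fin m)) ⊗ₜ[K] FreeAlgebra.ι K i
    (∀ x ∈ TwoSidedIdeal.span {y : FreeAlgebra K (Fin m) |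
          ∃ f : Fin (n + n' + 1) → Fin m,
            y = (List.ofFn fun t => FreeAlgebra.ι K (f t)).prod},
        Algebra.TensorProduct.map (RingQuot.mkAlgHom K (truncRel K m n))
          (RingQuot.mkAlgHom K (truncRel K m n')) (Δ x) = 0) ∧
      ∃ Δbar : TruncFreeAlgebra K m (n + n') →ₐ[K]
          (TruncFreeAlgebra K m n ⊗[K] TruncFreeAlgebra K m n'),
        (∀ x : FreeAlgebra K (Fin m),
            Δbar (RingQuot.mkAlgHom K (truncRel K m (n + n')) x) =
              Algebra.TensorProduct.map (RingQuot.mkAlgHom K (truncRel K m n))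
                (RingQuot.mkAlgHom K (truncRel K m n')) (Δ x)) ∧
          Δbar 1 = 1 ⊗ₜ[K] 1 ∧
          ∀ i : Fin m,
            Δbar (gen K m (n + n') i) =
              gen K m n i ⊗ₜ[K] 1 + 1 ⊗ₜ[K] gen K m n' i := by
  intro Δ
  set Φ : FreeAlgebra K (Fin m) →ₐ[K] (TruncFreeAlgebra K m n ⊗[K] TruncFreeAlgebra K m n') :=
    (Algebra.TensorProduct.map (RingQuot.mkAlgHom K (truncRel K m n))
      (RingQuot.mkAlgHom K (truncRel K m n'))).comp Δ with hΦ
  have hΔ : ∀ i, Φ (FreeAlgebra.ι K i) =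
      gen K m n i ⊗ₜ[K] 1 + 1 ⊗ₜ[K] gen K m n' i := by
    intro i
    simp [hΦ, Δ, gen]
  have hw : ∀ f : Fin (n + n' + 1) → Fin m,
      Φ (List.ofFn fun t => FreeAlgebra.ι K (f t)).prod = 0 := by
    intro f
    have h := aux_key K m n n' (List.ofFn f) [] [] (by simp)
    simp only [List.map_nil, List.prod_nil, map_one, ← Algebra.TensorProduct.one_def,
      one_mul] at h
    rw [map_list_prod, ← h]
    congr 1
    rw [List.map_ofFn, List.map_ofFn]
    congr 1
    funext t
    exact hΔ (f t)
  refine ⟨?_, RingQuot.liftAlgHom K ⟨Φ, ?_⟩, ?_, ?_, ?_⟩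
  · intro x hx
    have hle : TwoSidedIdeal.span {y : FreeAlgebra K (Fin m) |
          ∃ f : Fin (n + n' + 1) → Fin m,
            y = (List.ofFn fun t => FreeAlgebra.ι K (f t)).prod} ≤ TwoSidedIdeal.ker Φ := by
      rw [TwoSidedIdeal.span_le]
      rintro _ ⟨f, rfl⟩
      exact (TwoSidedIdeal.mem_ker Φ).2 (hw f)
    exact (TwoSidedIdeal.mem_ker Φ).1 (hle hx)
  · rintro x y ⟨⟨f, rfl⟩, rfl⟩
    rw [hw, map_zero]
  · intro x
    rw [RingQuot.liftAlgHom_mkAlgHom_apply]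
    rfl
  · rw [map_one, Algebra.TensorProduct.one_def]
  · intro i
    rw [gen, RingQuot.liftAlgHom_mkAlgHom_apply]
    exact hΔ i
end
end
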